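/- Let E be a spectral effect algebra, a ∈ E, and let {c_w}, {u_w} be the families associated with the binary spectral resolution of a. Then for any state s on E: (i) s(a) = lim_{n→∞} Σ_{w∈{0,1}^n} λ(w) s(u_w), and s(a) = 0 if and only if s(u_w) = 0 for every binary string w with λ(w) ≠ 0; (ii) if E is archimedean and s is σ-additive, then s(a) = 0 if and only if s(a°) = 0; (iii) if b ∈ E is such that p_{a,λ(w)} = p_{b,λ(w)} for all binary strings w, then s(a) = s(b). -/

import Mathlib

/- Common definitions: effect algebras, compression bases, spectrality -/

attribute [local instance 0] Classical.propDecidable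

universe u

structure EffectAlgebra (E : Type u) where
  padd : E → E → Option E
  zero : E
  one : E
  comm : ∀ a b, padd a b = padd b a
  assoc : ∀ a b c ab abc, padd a b = some ab → padd ab c = some abc →
      ∃ bc, padd b c = some bc ∧ padd a bc = some abc
  orth_exists : ∀ a, ∃ x, padd a x = some one
  orth_unique : ∀ a x y, padd a x = some one → padd a y = some one → x = y
  add_one : ∀ a b, padd a one = some b → a = zero

namespace EffectAlgebra

variable {E : Type u} (EA : EffectAlgebra E)

/-- `a ⊥ b` and `a ⊕ b = c`. -/
def le (a b : E) : Prop := ∃ c, EA.padd a c = some b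

/-- the orthosupplement `a'`. -/
noncomputable def compl (a : E) : E := (EA.orth_exists a).choose

/-- `b ⊖ a` (the element `c` with `a ⊕ c = b`, when it exists). -/
noncomputable def osub (b a : E) : E :=
  if h : ∃ c, EA.padd a c = some b then h.choose else EA.zero

/-- the value of `a ⊕ b` (defaulting to `0` when undefined). -/
noncomputable def oplusD (a b : E) : E := (EA.padd a b).getD EA.zero

def IsSharp (a : E) : Prop := ∀ x, EA.le x a → EA.le x (EA.compl a) → x = EA.zero

/-- sub-effect algebra. -/
def SubEA (P : Set E) : Prop :=
  EA.zero ∈ P ∧ EA.one ∈ P ∧ (∀ a ∈ P, EA.compl a ∈ P) ∧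
    ∀ a ∈ P, ∀ b ∈ P, ∀ c, EA.padd a b = some c → c ∈ P

/-- Mackey compatibility: `a = a₁ ⊕ c`, `b = b₁ ⊕ c` with `a₁ ⊕ b₁ ⊕ c` defined. -/
def Mackey (a b : E) : Prop :=
  ∃ a1 b1 c d e, EA.padd a1 b1 = some d ∧ EA.padd d c = some e ∧
    EA.padd a1 c = some a ∧ EA.padd b1 c = some b

def Additive (J : E → E) : Prop :=
  ∀ a b c, EA.padd a b = some c → EA.padd (J a) (J b) = some (J c)

def Retraction (J : E → E) : Prop :=
  EA.Additive J ∧ ∀ a, EA.le a (J EA.one) → J a = a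

def Compression (J : E → E) : Prop :=
  EA.Retraction J ∧ ∀ a, (J a = EA.zero ↔ EA.le a (EA.compl (J EA.one)))

/-- `I` is a supplement of `J`: `Ker J = ran I` and `Ker I = ran J`. -/
def Supplement (I J : E → E) : Prop :=
  (∀ a, J a = EA.zero ↔ ∃ b, I b = a) ∧ (∀ a, I a = EA.zero ↔ ∃ b, J b = a)

/-- the `n`-fold sum `n·a`, when defined. -/
def nsmulE : ℕ → E → Option E
  | 0, _ => some EA.zero
  | n + 1, a => (nsmulE n a).bind fun b => EA.padd a b

def ArchimedeanEA : Prop :=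
  ∀ a : E, (∀ n : ℕ, ∃ b, EA.nsmulE n a = some b) → a = EA.zero

/-- a state on an effect algebra. -/
def IsState (s : E → ℝ) : Prop :=
  s EA.one = 1 ∧ (∀ a, 0 ≤ s a ∧ s a ≤ 1) ∧
    ∀ a b c, EA.padd a b = some c → s c = s a + s b

noncomputable def partialSum (f : ℕ → E) : ℕ → E
  | 0 => EA.zero
  | n + 1 => EA.oplusD (partialSum f n) (f n)

/-- σ-additivity of a state: if all partial sums of an orthogonal sequence are defined
and the orthosum (= supremum of the partial sums) exists, the state is countably additive. -/
def SigmaAdditive (s : E → ℝ) : Prop :=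
  ∀ f : ℕ → E, ∀ b : E,
    (∀ n, ∃ c, EA.padd (EA.partialSum f n) (f n) = some c) →
    (∀ n, EA.le (EA.partialSum f n) b) →
    (∀ c, (∀ n, EA.le (EA.partialSum f n) c) → EA.le b c) →
    Filter.Tendsto (fun n => ∑ i ∈ Finset.range n, s (f i)) Filter.atTop (nhds (s b))

/-- A compression base: a family of compressions indexed by a sub-effect algebra `P`
such that each `p ∈ P` is the focus of `J p`, and Mackey compatible projections
compose to a projection. -/
structure CompressionBase {E : Type u} (EA : EffectAlgebra E) where
  P : Set E
  J : E → E → E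
  sub : EA.SubEA P
  compr : ∀ p ∈ P, EA.Compression (J p)
  focus : ∀ p ∈ P, J p EA.one = p
  mackey : ∀ p ∈ P, ∀ q ∈ P, EA.Mackey p q → ∃ r ∈ P, J p ∘ J q = J r

variable (CB : CompressionBase EA)

/-- `a ∈ C(p)`:  `a = J_p(a) ⊕ J_{p'}(a)`. -/
def inC (a p : E) : Prop :=
  EA.padd (CB.J p a) (CB.J (EA.compl p) a) = some a

/-- `PC(a) = {p ∈ P : a ∈ C(p)}`. -/
def PC (a : E) : Set E := {p | p ∈ CB.P ∧ inC EA CB a p}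

/-- the bicommutant `P(a)`. -/
def bicomm (a : E) : Set E :=
  {p | p ∈ PC EA CB a ∧ ∀ q ∈ PC EA CB a, inC EA CB p q}

/-- `PC(A)` for a set `A ⊆ E`. -/
def PCset (A : Set E) : Set E := {p | p ∈ CB.P ∧ ∀ a ∈ A, inC EA CB a p}

/-- `P(Q) = PC(PC(Q) ∪ Q)`. -/
def Pset (Q : Set E) : Set E := PCset EA CB (PCset EA CB Q ∪ Q)

/-- `P_≤(e,f)`. -/
def Ple (e f : E) : Set E :=
  {p | p ∈ Pset EA CB {e, f} ∧ EA.le (CB.J p e) (CB.J p f) ∧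
    EA.le (CB.J (EA.compl p) f) (CB.J (EA.compl p) e)}

/-- a Boolean subalgebra of `P`: a sub-effect algebra of `E` contained in `P`
whose elements are pairwise Mackey compatible, with witnesses inside. -/
def BooleanSub (B : Set E) : Prop :=
  B ⊆ CB.P ∧ EA.SubEA B ∧
    ∀ p ∈ B, ∀ q ∈ B, ∃ p1 ∈ B, ∃ q1 ∈ B, ∃ c ∈ B, ∃ d e,
      EA.padd p1 q1 = some d ∧ EA.padd d c = some e ∧
      EA.padd p1 c = some p ∧ EA.padd q1 c = some q

/-- `a` is a b-element with associated Boolean subalgebra `B`. -/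
def IsBElementWith (a : E) (B : Set E) : Prop :=
  BooleanSub EA CB B ∧ ∀ p ∈ CB.P, (inC EA CB a p ↔ ∀ b ∈ B, inC EA CB b p)

def IsBElement (a : E) : Prop := ∃ B, IsBElementWith EA CB a B

def BProperty : Prop := ∀ a : E, IsBElement EA CB a

/-- commuting of b-elements: `e C f` iff `P(e) ↔ P(f)`. -/
def CommuteEl (e f : E) : Prop :=
  ∀ p ∈ bicomm EA CB e, ∀ q ∈ bicomm EA CB f, EA.Mackey p q

def BComparability : Prop :=
  BProperty EA CB ∧ ∀ e f : E, CommuteEl EA CB e f → (Ple EA CB e f).Nonempty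

def IsProjCover (a p : E) : Prop :=
  p ∈ CB.P ∧ ∀ q ∈ CB.P, (EA.le a q ↔ EA.le p q)

def ProjCoverProp : Prop := ∀ a : E, ∃ p, IsProjCover EA CB a p

def Spectral : Prop := ProjCoverProp EA CB ∧ BComparability EA CB

/-- a block of `P`: a maximal set of pairwise Mackey compatible projections. -/
def IsBlock (B : Set E) : Prop :=
  B ⊆ CB.P ∧ (∀ p ∈ B, ∀ q ∈ B, EA.Mackey p q) ∧
    ∀ B' : Set E, B' ⊆ CB.P → (∀ p ∈ B', ∀ q ∈ B', EA.Mackey p q) → B ⊆ B' → B' = B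

/-- the C-block `C(B)`. -/
def Cblock (B : Set E) : Set E := {a | ∀ p ∈ B, inC EA CB a p}

/-- `(f − e)_+` (the positive part, defined when `P_≤(e,f)` is nonempty). -/
noncomputable def posPart (e f : E) : E :=
  if h : (Ple EA CB e f).Nonempty then
    EA.osub (CB.J h.some f) (CB.J h.some e)
  else EA.zero

noncomputable def projCover (a : E) : E :=
  if h : ∃ p, IsProjCover EA CB a p then h.choose else EA.zero

def IsMeetP (p q m : E) : Prop :=
  m ∈ CB.P ∧ EA.le m p ∧ EA.le m q ∧ ∀ s ∈ CB.P, EA.le s p → EA.le s q → EA.le s m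

/-- `p ∧ q` in `P`. -/
noncomputable def pmeet (p q : E) : E :=
  if h : ∃ m, IsMeetP EA CB p q m then h.choose else EA.zero

/-- infimum of a set of projections in `P`. -/
def IsInfP (S : Set E) (m : E) : Prop :=
  m ∈ CB.P ∧ (∀ s ∈ S, EA.le m s) ∧
    ∀ t ∈ CB.P, (∀ s ∈ S, EA.le t s) → EA.le t m

/-! Relative (to a projection `q`, i.e. computed in the interval `[0,q]`) notions. -/

def Pq (q : E) : Set E := {p | p ∈ CB.P ∧ EA.le p q}

def inCq (q a p : E) : Prop :=
  EA.padd (CB.J p a) (CB.J (EA.osub q p) a) = some a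

def PCq (q a : E) : Set E := {p | p ∈ Pq EA CB q ∧ inCq EA CB q a p}

def bicommq (q a : E) : Set E :=
  {p | p ∈ PCq EA CB q a ∧ ∀ r ∈ PCq EA CB q a, inCq EA CB q p r}

def PCsetq (q : E) (A : Set E) : Set E :=
  {p | p ∈ Pq EA CB q ∧ ∀ a ∈ A, inCq EA CB q a p}

def Psetq (q : E) (Q : Set E) : Set E := PCsetq EA CB q (PCsetq EA CB q Q ∪ Q)

def Pleq (q e f : E) : Set E :=
  {p | p ∈ Psetq EA CB q {e, f} ∧ EA.le (CB.J p e) (CB.J p f) ∧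
    EA.le (CB.J (EA.osub q p) f) (CB.J (EA.osub q p) e)}

noncomputable def posPartq (q e f : E) : E :=
  if h : (Pleq EA CB q e f).Nonempty then
    EA.osub (CB.J h.some f) (CB.J h.some e)
  else EA.zero

def IsProjCoverq (q a p : E) : Prop :=
  p ∈ Pq EA CB q ∧ ∀ s ∈ Pq EA CB q, (EA.le a s ↔ EA.le p s)

noncomputable def projCoverq (q a : E) : E :=
  if h : ∃ p, IsProjCoverq EA CB q a p then h.choose else EA.zero

def Mackeyq (q a b : E) : Prop :=
  ∃ a1 b1 c d e, EA.padd a1 b1 = some d ∧ EA.padd d c = some e ∧ EA.le e q ∧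
    EA.padd a1 c = some a ∧ EA.padd b1 c = some b

def SubEAq (q : E) (F : Set E) : Prop :=
  EA.zero ∈ F ∧ q ∈ F ∧ (∀ x ∈ F, EA.osub q x ∈ F) ∧
    ∀ x ∈ F, ∀ y ∈ F, ∀ z, EA.padd x y = some z → EA.le z q → z ∈ F

def BooleanSubq (q : E) (B : Set E) : Prop :=
  B ⊆ Pq EA CB q ∧ SubEAq EA q B ∧
    ∀ p ∈ B, ∀ r ∈ B, ∃ p1 ∈ B, ∃ r1 ∈ B, ∃ c ∈ B, ∃ d e,
      EA.padd p1 r1 = some d ∧ EA.padd d c = some e ∧ EA.le e q ∧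
      EA.padd p1 c = some p ∧ EA.padd r1 c = some r

def IsBElementq (q a : E) : Prop :=
  ∃ B, BooleanSubq EA CB q B ∧
    ∀ p ∈ Pq EA CB q, (inCq EA CB q a p ↔ ∀ b ∈ B, inCq EA CB q b p)

def BPropertyq (q : E) : Prop := ∀ a : E, EA.le a q → IsBElementq EA CB q a

def CommuteElq (q e f : E) : Prop :=
  ∀ p ∈ bicommq EA CB q e, ∀ r ∈ bicommq EA CB q f, Mackeyq EA q p r

def BComparabilityq (q : E) : Prop :=
  BPropertyq EA CB q ∧ ∀ e f : E, EA.le e q → EA.le f q →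
    CommuteElq EA CB q e f → (Pleq EA CB q e f).Nonempty

/-! The binary spectral resolution. -/

/-- `λ(w) = Σ_j w_j 2^{-j}` (head of the list is the first digit). -/
def lamOf : List Bool → ℚ
  | [] => 0
  | b :: t => ((if b then 1 else 0) + lamOf t) / 2

/-- all binary strings of length `n`, in lexicographic order. -/
def allStrings : ℕ → List (List Bool)
  | 0 => [[]]
  | n + 1 => (allStrings n).flatMap fun w => [w ++ [false], w ++ [true]]

noncomputable def listSum (l : List E) : E :=
  l.foldl (fun acc x => EA.oplusD acc x) EA.zero

/-- the families `(u_w, c_w)`; the binary string is given in reversed order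
(head of the list is the last digit). -/
noncomputable def ucAux (a : E) : List Bool → E × E
  | [] => (projCover EA CB a, a)
  | bit :: t =>
      let p := ucAux a t
      let q := p.1
      let cw := p.2
      let cw' := EA.osub q cw
      let d := posPartq EA CB q cw' cw
      let u0 := pmeet EA CB (EA.osub q (projCoverq EA CB q d)) q
      if bit then (pmeet EA CB q (EA.compl u0), d)
      else (u0, EA.oplusD (CB.J u0 cw) (CB.J u0 cw))

noncomputable def uw (a : E) (w : List Bool) : E := (ucAux EA CB a w.reverse).1

noncomputable def cw (a : E) (w : List Bool) : E := (ucAux EA CB a w.reverse).2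

/-- the binary spectral projection `p_{a,λ(w1)}`. -/
noncomputable def pbin (a : E) (w : List Bool) : E :=
  listSum EA (EA.compl (projCover EA CB a) ::
    (((allStrings (w.length + 1)).filter
        fun v => lamOf v ≤ lamOf (w ++ [false])).map (uw EA CB a)))

def Dyadic01 (x : ℚ) : Prop := ∃ n k : ℕ, (k : ℚ) ≤ 2 ^ n ∧ x = (k : ℚ) / 2 ^ n

/-- the binary spectral resolution `p_{a,λ}`, for dyadic rationals `λ ∈ [0,1]`. -/
noncomputable def pdyad (a : E) (x : ℚ) : E :=
  if x ≤ 0 then EA.compl (projCover EA CB a)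
  else if 1 ≤ x then EA.one
  else if h : ∃ w : List Bool, lamOf (w ++ [true]) = x then pbin EA CB a h.choose
  else EA.zero

/-- the rational spectral resolution `p_{a,λ} = ⋀_{μ > λ, μ dyadic} p_{a,μ}`. -/
noncomputable def ratRes (a : E) (x : ℚ) : E :=
  if h : ∃ m, IsInfP EA CB {y | ∃ μ, Dyadic01 μ ∧ x < μ ∧ y = pdyad EA CB a μ} m
  then h.choose else EA.zero

/-- the partial maps `f_0(b) = 2b`, `f_1(b) = (2b')'` computed in `[0,uu]`. -/
noncomputable def fstep (uu b : E) (bit : Bool) : Option E :=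
  if bit then
    (if EA.le (EA.osub uu b) b
      then some (EA.osub uu (EA.oplusD (EA.osub uu b) (EA.osub uu b))) else none)
  else
    (if EA.le b (EA.osub uu b) then some (EA.oplusD b b) else none)

/-- `f_w = f_{w_n} ∘ ⋯ ∘ f_{w_1}`, computed in `[0,uu]`, as a partial map. -/
noncomputable def fword (uu : E) (w : List Bool) (b : E) : Option E :=
  w.foldl (fun ob bit => ob.bind fun x => fstep EA uu x bit) (some b)

end EffectAlgebra

namespace EffectAlgebra

section basics

variable {E : Type u} {EA : EffectAlgebra E}

theorem pcomm {a b c : E} (h : EA.padd a b = some c) : EA.padd b a = some c := by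
  rw [EA.comm]; exact h

theorem passoc {a b c ab abc : E} (h : EA.padd a b = some ab) (h2 : EA.padd ab c = some abc) :
    ∃ bc, EA.padd b c = some bc ∧ EA.padd a bc = some abc :=
  EA.assoc a b c ab abc h h2

theorem passoc' {a b c bc abc : E} (h : EA.padd b c = some bc) (h2 : EA.padd a bc = some abc) :
    ∃ ab, EA.padd a b = some ab ∧ EA.padd ab c = some abc := by
  obtain ⟨x, hx, hx2⟩ := passoc (pcomm h) (pcomm h2)
  exact ⟨x, pcomm hx, pcomm hx2⟩

theorem pfun {a b c d : E} (h : EA.padd a b = some c) (h2 : EA.padd a b = some d) : c = d := by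
  rw [h] at h2; exact Option.some.inj h2

theorem compl_spec (a : E) : EA.padd a (EA.compl a) = some EA.one := (EA.orth_exists a).choose_spec

theorem compl_eq {a b : E} (h : EA.padd a b = some EA.one) : EA.compl a = b :=
  EA.orth_unique _ _ _ (compl_spec a) h

theorem compl_compl (a : E) : EA.compl (EA.compl a) = a := compl_eq (pcomm (compl_spec a))

theorem padd_zero (a : E) : EA.padd a EA.zero = some a := by
  have h1 : EA.padd EA.one EA.zero = some EA.one := by
    obtain ⟨x, hx⟩ := EA.orth_exists EA.one
    have := EA.add_one x EA.one (pcomm hx)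
    rw [← this]; exact hx
  obtain ⟨t, ht, ht2⟩ := passoc (pcomm (compl_spec a)) h1
  have : t = a := EA.orth_unique _ _ _ ht2 (pcomm (compl_spec a))
  rw [← this]; rw [this] at ht ⊢; exact ht

theorem zero_padd (a : E) : EA.padd EA.zero a = some a := pcomm (padd_zero a)

theorem cancel {a b b2 c : E} (h : EA.padd a b = some c) (h2 : EA.padd a b2 = some c) : b = b2 := by
  obtain ⟨t, ht, ht2⟩ := passoc (pcomm h) (compl_spec c)
  obtain ⟨t', ht', ht2'⟩ := passoc (pcomm h2) (compl_spec c)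
  have := pfun ht ht'
  subst this
  exact EA.orth_unique t _ _ (pcomm ht2) (pcomm ht2')

theorem cancel' {a a2 b c : E} (h : EA.padd a b = some c) (h2 : EA.padd a2 b = some c) : a = a2 :=
  cancel (pcomm h) (pcomm h2)

theorem eq_zero_of_add {a b : E} (h : EA.padd a b = some EA.zero) : a = EA.zero := by
  obtain ⟨t, ht, _⟩ := passoc (pcomm h) (zero_padd EA.one)
  exact EA.add_one _ _ ht

theorem four {a b c d x y t : E} (h1 : EA.padd a b = some x) (h2 : EA.padd c d = some y)
    (h3 : EA.padd x y = some t) :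
    ∃ v w, EA.padd a c = some v ∧ EA.padd b d = some w ∧ EA.padd v w = some t := by
  obtain ⟨m, hm, hm2⟩ := passoc h1 h3
  obtain ⟨n, hn, hn2⟩ := passoc' h2 hm
  obtain ⟨k, hk, hk2⟩ := passoc (pcomm hn) hn2
  obtain ⟨l, hl, hl2⟩ := passoc' hk2 hm2
  exact ⟨l, k, hl, hk, hl2⟩

theorem le_refl' (a : E) : EA.le a a := ⟨_, padd_zero a⟩
theorem zero_le' (a : E) : EA.le EA.zero a := ⟨_, zero_padd a⟩
theorem le_one' (a : E) : EA.le a EA.one := ⟨_, compl_spec a⟩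
theorem le_left {a b c : E} (h : EA.padd a b = some c) : EA.le a c := ⟨_, h⟩
theorem le_right {a b c : E} (h : EA.padd a b = some c) : EA.le b c := ⟨_, pcomm h⟩

theorem le_tr {a b c : E} (h : EA.le a b) (h2 : EA.le b c) : EA.le a c := by
  obtain ⟨x, hx⟩ := h
  obtain ⟨y, hy⟩ := h2
  obtain ⟨t, _, ht⟩ := passoc hx hy
  exact ⟨t, ht⟩

theorem le_asymm {a b : E} (h : EA.le a b) (h2 : EA.le b a) : a = b := by
  obtain ⟨x, hx⟩ := h
  obtain ⟨y, hy⟩ := h2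
  obtain ⟨t, ht, ht2⟩ := passoc hx hy
  have := cancel ht2 (padd_zero a)
  subst this
  have := eq_zero_of_add ht
  subst this
  exact pfun (padd_zero a) hx

theorem le_zero {a : E} (h : EA.le a EA.zero) : a = EA.zero := le_asymm h (zero_le' a)

theorem orth_iff {a b : E} : (∃ c, EA.padd a b = some c) ↔ EA.le a (EA.compl b) := by
  constructor
  · rintro ⟨c, hc⟩
    obtain ⟨t, ht, ht2⟩ := passoc (pcomm hc) (compl_spec c)
    exact ⟨_, by rw [compl_eq ht2]; exact ht⟩
  · rintro ⟨x, hx⟩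
    obtain ⟨t, ht, ht2⟩ := passoc' hx (compl_spec b)
    exact ⟨_, pcomm ht⟩

theorem le_compl_symm {a b : E} (h : EA.le a (EA.compl b)) : EA.le b (EA.compl a) := by
  obtain ⟨c, hc⟩ := orth_iff.2 h
  exact orth_iff.1 ⟨c, pcomm hc⟩

theorem compl_anti {a b : E} (h : EA.le a b) : EA.le (EA.compl b) (EA.compl a) := by
  apply le_compl_symm
  rw [compl_compl]; exact h

theorem le_of_compl {a b : E} (h : EA.le (EA.compl b) (EA.compl a)) : EA.le a b := by
  have := compl_anti h
  rwa [compl_compl, compl_compl] at this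

theorem compl_one' : EA.compl EA.one = EA.zero := compl_eq (padd_zero _)

theorem osub_spec {a b : E} (h : EA.le a b) : EA.padd a (EA.osub b a) = some b := by
  unfold osub
  have h' : ∃ c, EA.padd a c = some b := h
  rw [dif_pos h']
  exact h'.choose_spec

theorem osub_eq {a b c : E} (h : EA.padd a c = some b) : EA.osub b a = c :=
  cancel (osub_spec ⟨_, h⟩) h

theorem oplusD_eq {a b c : E} (h : EA.padd a b = some c) : EA.oplusD a b = c := by
  simp [oplusD, h]

theorem padd_mono {a b c a2 b2 : E} (h : EA.padd a b = some c) (ha : EA.le a2 a) (hb : EA.le b2 b) :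
    ∃ d, EA.padd a2 b2 = some d ∧ EA.le d c := by
  obtain ⟨x, hx⟩ := ha
  obtain ⟨y, hy⟩ := hb
  obtain ⟨v, w, hv, _, hvw⟩ := four hx hy h
  exact ⟨v, hv, w, hvw⟩

theorem nsmul_add {z x y t : E} {m k : ℕ} (hx : EA.nsmulE m z = some x)
    (hy : EA.nsmulE k z = some y) (ht : EA.padd x y = some t) :
    EA.nsmulE (m + k) z = some t := by
  induction m generalizing x t with
  | zero =>
    simp only [nsmulE, Option.some.injEq] at hx
    subst hx
    rw [zero_padd] at ht
    rw [Nat.zero_add, hy, ht]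
  | succ m ih =>
    rw [nsmulE, Option.bind_eq_some_iff] at hx
    obtain ⟨x', hx', hx2⟩ := hx
    obtain ⟨w, hw, hw2⟩ := passoc hx2 ht
    have := ih hx' hw
    rw [show m + 1 + k = (m + k) + 1 by omega, nsmulE, this]
    exact hw2

theorem nsmul_le {z x : E} {m k : ℕ} (hmk : m ≤ k) (hx : EA.nsmulE k z = some x) :
    ∃ y, EA.nsmulE m z = some y := by
  induction hmk generalizing x with
  | refl => exact ⟨x, hx⟩
  | step _ ih =>
    rw [nsmulE, Option.bind_eq_some_iff] at hx
    obtain ⟨x', hx', _⟩ := hx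
    exact ih hx'

theorem arch_double (hA : EA.ArchimedeanEA) (z : ℕ → E)
    (hz : ∀ n, EA.padd (z n) (z n) = some (z (n+1))) : z 0 = EA.zero := by
  have key : ∀ n, EA.nsmulE (2 ^ n) (z 0) = some (z n) := by
    intro n
    induction n with
    | zero => simp [nsmulE, padd_zero]
    | succ n ih => rw [pow_succ, mul_two]; exact nsmul_add ih ih (hz n)
  exact hA _ fun n => nsmul_le (Nat.lt_two_pow_self).le (key n)

end basics

section comprs

variable {E : Type u} {EA : EffectAlgebra E} {CB : CompressionBase EA}

theorem P_compl {p : E} (hp : p ∈ CB.P) : EA.compl p ∈ CB.P := CB.sub.2.2.1 p hp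
theorem P_add {p q r : E} (hp : p ∈ CB.P) (hq : q ∈ CB.P) (h : EA.padd p q = some r) : r ∈ CB.P :=
  CB.sub.2.2.2 p hp q hq r h
theorem P_sub {p q r : E} (hq : q ∈ CB.P) (hr : r ∈ CB.P) (h : EA.padd p q = some r) :
    p ∈ CB.P := by
  obtain ⟨t, ht, ht2⟩ := passoc h (compl_spec r)
  have := P_compl (P_add hq (P_compl hr) ht)
  rwa [compl_eq (pcomm ht2)] at this

theorem J_add {p a b c : E} (hp : p ∈ CB.P) (h : EA.padd a b = some c) :
    EA.padd (CB.J p a) (CB.J p b) = some (CB.J p c) := (CB.compr p hp).1.1 a b c h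

theorem J_fix {p a : E} (hp : p ∈ CB.P) (h : EA.le a p) : CB.J p a = a :=
  (CB.compr p hp).1.2 a (by rw [CB.focus p hp]; exact h)

theorem J_zero_iff {p a : E} (hp : p ∈ CB.P) : CB.J p a = EA.zero ↔ EA.le a (EA.compl p) := by
  have := (CB.compr p hp).2 a
  rwa [CB.focus p hp] at this

theorem J_mono {p a b : E} (hp : p ∈ CB.P) (h : EA.le a b) : EA.le (CB.J p a) (CB.J p b) := by
  obtain ⟨x, hx⟩ := h
  exact ⟨_, J_add hp hx⟩

theorem J_le {p : E} (hp : p ∈ CB.P) (a : E) : EA.le (CB.J p a) p := by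
  have := J_mono (CB := CB) hp (le_one' a)
  rwa [CB.focus p hp] at this

theorem J_ge {p q : E} (hp : p ∈ CB.P) (h : EA.le p q) : CB.J p q = p := by
  apply le_asymm (J_le hp q)
  have := J_mono hp h
  rwa [J_fix hp (le_refl' p)] at this

/-- projections are principal -/
theorem principal {p a b c : E} (hp : p ∈ CB.P) (ha : EA.le a p) (hb : EA.le b p)
    (h : EA.padd a b = some c) : EA.le c p := by
  have h2 := J_add hp h
  rw [J_fix hp ha, J_fix hp hb] at h2
  rw [pfun h h2]
  exact J_le hp c

/-- `a` is a sum of an element under `p` and one under `p'` -/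
theorem inC_iff {p a : E} (hp : p ∈ CB.P) :
    inC EA CB a p ↔ ∃ x y, EA.le x p ∧ EA.le y (EA.compl p) ∧ EA.padd x y = some a := by
  constructor
  · intro h
    exact ⟨_, _, J_le hp a, J_le (P_compl hp) a, h⟩
  · rintro ⟨x, y, hx, hy, h⟩
    have h1 := J_add hp h
    have h2 := J_add (P_compl hp) h
    rw [J_fix hp hx, (J_zero_iff hp).2 hy, padd_zero] at h1
    rw [J_fix (P_compl hp) hy, (J_zero_iff (P_compl hp)).2 (by rwa [compl_compl]), zero_padd] at h2
    unfold inC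
    rw [← Option.some.inj h1, ← Option.some.inj h2]
    exact h

theorem inC_of_le {p a : E} (hp : p ∈ CB.P) (h : EA.le a p) : inC EA CB a p :=
  (inC_iff hp).2 ⟨a, EA.zero, h, zero_le' _, padd_zero a⟩

theorem inC_compl {p a : E} (h : inC EA CB a p) : inC EA CB a (EA.compl p) := by
  unfold inC at *
  rw [compl_compl]
  exact pcomm h

theorem inC_diff {p a b c : E} (hp : p ∈ CB.P) (h : EA.padd a b = some c) (ha : inC EA CB a p)
    (hc : inC EA CB c p) : inC EA CB b p := by
  have h1 := J_add hp h
  have h2 := J_add (P_compl hp) h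
  obtain ⟨v, w, hv, hw, hvw⟩ := four h1 h2 hc
  have := pfun hv ha
  subst this
  have := cancel hvw h
  subst this
  exact hw

theorem inC_one {p : E} (hp : p ∈ CB.P) : inC EA CB EA.one p := by
  unfold inC
  rw [CB.focus p hp, CB.focus _ (P_compl hp)]
  exact compl_spec p

theorem mackey_iff {p a : E} (hp : p ∈ CB.P) : EA.Mackey a p ↔ inC EA CB a p := by
  rw [inC_iff hp]
  constructor
  · rintro ⟨a1, b1, c, d, e, h1, h2, h3, h4⟩
    obtain ⟨t, ht, ht2⟩ := passoc h1 h2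
    have := pfun ht h4
    subst this
    exact ⟨c, a1, le_right h4, orth_iff.1 ⟨_, ht2⟩, pcomm h3⟩
  · rintro ⟨x, y, hx, hy, h⟩
    obtain ⟨e, he⟩ := orth_iff.2 hy
    have hs := osub_spec hx
    obtain ⟨d, hd, hd2⟩ := passoc' (pcomm hs) he
    exact ⟨y, EA.osub p x, x, d, e, hd, hd2, pcomm h, pcomm hs⟩

theorem mackey_symm {a b : E} (h : EA.Mackey a b) : EA.Mackey b a := by
  obtain ⟨a1, b1, c, d, e, h1, h2, h3, h4⟩ := h
  exact ⟨b1, a1, c, d, e, pcomm h1, h2, h4, h3⟩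

theorem inC_symm {p q : E} (hp : p ∈ CB.P) (hq : q ∈ CB.P) (h : inC EA CB p q) :
    inC EA CB q p :=
  (mackey_iff hp).1 (mackey_symm ((mackey_iff hq).2 h))

/-- meets of commuting projections -/
theorem meet_comm {p q : E} (hp : p ∈ CB.P) (hq : q ∈ CB.P) (h : inC EA CB q p) :
    CB.J p q ∈ CB.P ∧ CB.J p ∘ CB.J q = CB.J (CB.J p q) ∧ EA.le (CB.J p q) q := by
  obtain ⟨r, hr, hr2⟩ := CB.mackey p hp q hq (mackey_symm ((mackey_iff hp).2 h))
  have e : r = CB.J p q := by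
    have := congrFun hr2 EA.one
    rw [Function.comp, CB.focus q hq, CB.focus r hr] at this
    exact this.symm
  subst e
  exact ⟨hr, hr2, le_left h⟩

theorem J_comm {p q : E} (hp : p ∈ CB.P) (hq : q ∈ CB.P) (h : inC EA CB q p) (x : E) :
    CB.J p (CB.J q x) = CB.J q (CB.J p x) := by
  obtain ⟨h1, h2, h3⟩ := meet_comm hp hq h
  obtain ⟨k1, k2, k3⟩ := meet_comm hq hp (inC_symm hq hp h)
  have e : CB.J p q = CB.J q p := by
    apply le_asymm
    · have := J_mono hq (J_le (CB := CB) hp q)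
      rwa [J_fix hq h3] at this
    · have := J_mono hp (J_le (CB := CB) hq p)
      rwa [J_fix hp k3] at this
  have a1 := congrFun h2 x
  have a2 := congrFun k2 x
  rw [← e] at a2
  exact a1.trans a2.symm

theorem le_meet {p q x : E} (hp : p ∈ CB.P) (hxp : EA.le x p) (hxq : EA.le x q) :
    EA.le x (CB.J p q) := by
  have := J_mono hp hxq
  rwa [J_fix hp hxp] at this

theorem le_osub {p q x : E} (hq : q ∈ CB.P) (hpq : EA.le p q) (hxq : EA.le x q)
    (h : EA.le x (EA.compl p)) : EA.le x (EA.osub q p) := by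
  obtain ⟨t, ht⟩ := orth_iff.2 h
  obtain ⟨y, hy⟩ := principal hq hxq hpq ht
  obtain ⟨z, hz, hz2⟩ := passoc (pcomm ht) hy
  rw [osub_eq hz2]
  exact le_left hz

theorem osub_le_compl {p q : E} (hpq : EA.le p q) : EA.le (EA.osub q p) (EA.compl p) :=
  orth_iff.1 ⟨_, pcomm (osub_spec hpq)⟩

theorem osub_le {p q : E} (hpq : EA.le p q) : EA.le (EA.osub q p) q := le_right (osub_spec hpq)

theorem osub_mem {p q : E} (hp : p ∈ CB.P) (hq : q ∈ CB.P) (hpq : EA.le p q) :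
    EA.osub q p ∈ CB.P := P_sub hp hq (pcomm (osub_spec hpq))

theorem inCq_iff {q p a : E} (hq : q ∈ CB.P) (hp : p ∈ CB.P) (hpq : EA.le p q) :
    inCq EA CB q a p ↔ EA.le a q ∧ inC EA CB a p := by
  have hm := osub_mem hp hq hpq
  constructor
  · intro h
    refine ⟨principal hq (le_tr (J_le hp a) hpq) (le_tr (J_le hm a) (osub_le hpq)) h, ?_⟩
    exact (inC_iff hp).2 ⟨_, _, J_le hp a, le_tr (J_le hm a) (osub_le_compl hpq), h⟩
  · rintro ⟨h1, h2⟩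
    obtain ⟨x, y, hx, hy, h⟩ := (inC_iff hp).1 h2
    have hy2 := le_osub hq hpq (le_tr (le_right h) h1) hy
    have k1 := J_add hp h
    have k2 := J_add hm h
    rw [J_fix hp hx, (J_zero_iff hp).2 hy, padd_zero] at k1
    rw [J_fix hm hy2, (J_zero_iff hm).2 (le_tr hx (le_compl_symm (osub_le_compl hpq))),
      zero_padd] at k2
    unfold inCq
    rw [← Option.some.inj k1, ← Option.some.inj k2]
    exact h

/-- for `x ≤ q` commuting with `p`, `x` commutes with `p ∧ q` -/
theorem inC_meet {p q x : E} (hp : p ∈ CB.P) (hq : q ∈ CB.P) (h : inC EA CB q p)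
    (hx : EA.le x q) (hxp : inC EA CB x p) : inC EA CB x (CB.J p q) := by
  obtain ⟨h1, _, _⟩ := meet_comm hp hq h
  obtain ⟨y, z, hy, hz, hyz⟩ := (inC_iff hp).1 hxp
  exact (inC_iff h1).2 ⟨y, z, le_meet hp hy (le_tr (le_left hyz) hx),
    le_tr hz (compl_anti (J_le hp q)), hyz⟩

theorem J_meet_le {p q x y : E} (hp : p ∈ CB.P) (hq : q ∈ CB.P) (h : inC EA CB q p)
    (hxy : EA.le (CB.J p x) (CB.J p y)) :
    EA.le (CB.J (CB.J p q) (CB.J q x)) (CB.J (CB.J p q) (CB.J q y)) := by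
  have e : ∀ z, CB.J (CB.J p q) (CB.J q z) = CB.J q (CB.J p z) := by
    intro z
    rw [← (meet_comm hp hq h).2.1, Function.comp, J_fix hq (J_le hq z), J_comm hp hq h]
  rw [e, e]
  exact J_mono hq hxy

theorem Pleq_nonempty (hspec : Spectral EA CB) {q c : E} (hq : q ∈ CB.P) (hc : EA.le c q) :
    (Pleq EA CB q (EA.osub q c) c).Nonempty := by
  have hco : ∀ p ∈ CB.P, (inC EA CB (EA.compl c) p ↔ inC EA CB c p) := fun p hp =>
    ⟨fun h => inC_diff hp (pcomm (compl_spec c)) h (inC_one hp),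
     fun h => inC_diff hp (compl_spec c) h (inC_one hp)⟩
  have hcom : CommuteEl EA CB (EA.compl c) c := by
    intro p hp r hr
    exact (mackey_iff hr.1.1).2 (hp.2 r ⟨hr.1.1, (hco r hr.1.1).2 hr.1.2⟩)
  obtain ⟨p, hp, hle1, hle2⟩ := hspec.2.2 _ _ hcom
  have hpP : p ∈ CB.P := hp.1
  have hpc' : EA.compl p ∈ CB.P := P_compl hpP
  have hcp : inC EA CB c p := hp.2 c (Or.inr (by simp))
  have hcomm : ∀ t ∈ CB.P, inC EA CB c t → inC EA CB t p := by
    intro t ht htc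
    apply hp.2 t (Or.inl ⟨ht, ?_⟩)
    intro a ha
    rcases ha with rfl | ha
    · exact (hco t ht).2 htc
    · rw [Set.mem_singleton_iff] at ha
      subst ha; exact htc
  have hqp := hcomm q hq (inC_of_le hq hc)
  have hqp' := inC_compl hqp
  obtain ⟨hr, _, hrq⟩ := meet_comm hpP hq hqp
  have hosub : EA.osub q (CB.J p q) = CB.J (EA.compl p) q := osub_eq hqp
  have hJc : CB.J q c = c := J_fix hq hc
  have hJc' : CB.J q (EA.compl c) = EA.osub q c := by
    have := J_add hq (compl_spec c)
    rw [hJc, CB.focus q hq] at this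
    exact (osub_eq this).symm
  have hcr : inC EA CB c (CB.J p q) := inC_meet hpP hq hqp hc hcp
  refine ⟨CB.J p q, ⟨⟨hr, hrq⟩, ?_⟩, ?_, ?_⟩
  · intro t ht
    rw [inCq_iff hq hr hrq]
    rcases ht with ht | ht
    · have h1 := ht.2 c (by simp)
      rw [inCq_iff hq ht.1.1 ht.1.2] at h1
      exact ⟨ht.1.2, inC_meet hpP hq hqp ht.1.2 (hcomm t ht.1.1 h1.2)⟩
    · rcases ht with rfl | ht
      · exact ⟨osub_le hc, inC_diff hr (osub_spec hc) hcr
          (inC_meet hpP hq hqp (le_refl' q) hqp)⟩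
      · rw [Set.mem_singleton_iff] at ht
        subst ht; exact ⟨hc, hcr⟩
  · have := J_meet_le hpP hq hqp hle1
    rwa [hJc, hJc'] at this
  · have := J_meet_le hpc' hq hqp' hle2
    rw [hosub]
    rwa [hJc, hJc'] at this

theorem projCover_spec (hspec : Spectral EA CB) (a : E) : IsProjCover EA CB a (projCover EA CB a) := by
  unfold projCover
  rw [dif_pos (hspec.1 a)]
  exact (hspec.1 a).choose_spec

theorem cover_le {a p : E} (h : IsProjCover EA CB a p) : EA.le a p := (h.2 p h.1).2 (le_refl' p)

theorem projCoverq_spec (hspec : Spectral EA CB) {q d : E} (hq : q ∈ CB.P) (hd : EA.le d q) :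
    IsProjCover EA CB d (projCoverq EA CB q d) := by
  have h0 := projCover_spec hspec d
  have hle : EA.le (projCover EA CB d) q := (h0.2 q hq).1 hd
  have hex : ∃ p, IsProjCoverq EA CB q d p :=
    ⟨_, ⟨h0.1, hle⟩, fun s hs => h0.2 s hs.1⟩
  have hsp : IsProjCoverq EA CB q d (projCoverq EA CB q d) := by
    unfold projCoverq
    rw [dif_pos hex]
    exact hex.choose_spec
  have : projCoverq EA CB q d = projCover EA CB d := by
    apply le_asymm
    · exact (hsp.2 _ ⟨h0.1, hle⟩).1 (cover_le h0)
    · exact (h0.2 _ hsp.1.1).1 ((hsp.2 _ hsp.1).2 (le_refl' _))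
  rw [this]; exact h0

theorem cover_comm (hspec : Spectral EA CB) {d e r : E} (he : IsProjCover EA CB d e) (hr : r ∈ CB.P)
    (h : inC EA CB d r) : inC EA CB e r := by
  have hr' := P_compl hr
  have h1 := projCover_spec hspec (CB.J r d)
  have h2 := projCover_spec hspec (CB.J (EA.compl r) d)
  have l1 : EA.le (projCover EA CB (CB.J r d)) r := (h1.2 r hr).1 (J_le hr d)
  have l2 : EA.le (projCover EA CB (CB.J (EA.compl r) d)) (EA.compl r) :=
    (h2.2 _ hr').1 (J_le hr' d)
  obtain ⟨f, hf, _⟩ := padd_mono (compl_spec r) l1 l2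
  have hfP := P_add h1.1 h2.1 hf
  have hef : EA.le e f := by
    apply (he.2 f hfP).1
    exact principal hfP (le_tr (cover_le h1) (le_left hf)) (le_tr (cover_le h2) (le_right hf)) h
  have hfe : EA.le f e := by
    refine principal he.1 ((h1.2 e he.1).1 ?_) ((h2.2 e he.1).1 ?_) hf
    · exact le_tr (le_left h) (cover_le he)
    · exact le_tr (le_right h) (cover_le he)
  have := le_asymm hef hfe
  subst this
  exact (inC_iff hr).2 ⟨_, _, l1, l2, hf⟩

theorem pmeet_eq {p q m : E} (h : IsMeetP EA CB p q m) : pmeet EA CB p q = m := by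
  have hex : ∃ m, IsMeetP EA CB p q m := ⟨m, h⟩
  have hs : IsMeetP EA CB p q (pmeet EA CB p q) := by
    unfold pmeet
    rw [dif_pos hex]
    exact hex.choose_spec
  exact le_asymm (h.2.2.2 _ hs.1 hs.2.1 hs.2.2.1) (hs.2.2.2 _ h.1 h.2.1 h.2.2.1)

theorem inC_J {p r x : E} (hp : p ∈ CB.P) (hr : r ∈ CB.P) (h : inC EA CB r p) (hx : inC EA CB x r) :
    inC EA CB (CB.J p x) r := by
  have hr' := P_compl hr
  have h' : inC EA CB (EA.compl r) p := inC_diff hp (compl_spec r) h (inC_one hp)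
  have := J_add hp hx
  rw [J_comm hp hr h, J_comm hp hr' h'] at this
  exact this

/-- The basic step of the binary spectral resolution. -/
theorem step (hspec : Spectral EA CB) {q c d e : E} (hq : q ∈ CB.P) (hc : EA.le c q)
    (hd : d = posPartq EA CB q (EA.osub q c) c) (he : e = projCoverq EA CB q d) :
    e ∈ CB.P ∧ EA.le e q ∧ EA.le d e ∧
    EA.padd (CB.J (EA.osub q e) c) (CB.J e c) = some c ∧
    (∃ t, EA.padd (CB.J (EA.osub q e) c) (CB.J (EA.osub q e) c) = some t ∧ EA.le t (EA.osub q e)) ∧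
    (∃ y, EA.padd y d = some (CB.J e c) ∧ EA.padd y (CB.J e c) = some e) := by
  have hne := Pleq_nonempty hspec hq hc
  have hc' := osub_spec hc
  obtain ⟨p, hp, hdp⟩ : ∃ p ∈ Pleq EA CB q (EA.osub q c) c,
      d = EA.osub (CB.J p c) (CB.J p (EA.osub q c)) := by
    refine ⟨hne.some, hne.some_mem, ?_⟩
    rw [hd, posPartq, dif_pos hne]
  clear hd
  generalize EA.osub q c = c' at *
  obtain ⟨⟨⟨hpP, hpq⟩, hpc⟩, hle1, hle2⟩ := hp
  have hd : EA.padd (CB.J p c') d = some (CB.J p c) := by rw [hdp]; exact osub_spec hle1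
  have hcq : inCq EA CB q c p := hpc c (Or.inr (by simp))
  have hcq' : inCq EA CB q c' p := hpc c' (Or.inr (by simp))
  have hdle : EA.le d p := le_tr (le_right hd) (J_le hpP c)
  have hcov := projCoverq_spec hspec hq (le_tr hdle hpq)
  rw [← he] at hcov
  have heP := hcov.1
  have hep : EA.le e p := (hcov.2 p hpP).1 hdle
  have heq : EA.le e q := le_tr hep hpq
  have hde := cover_le hcov
  have hmp := osub_mem hpP hq hpq
  have hu0 := osub_mem heP hq heq
  -- c commutes with e
  have hce : inC EA CB c e := by
    obtain ⟨B, ⟨hBP, _, hBM⟩, hB⟩ := hspec.2.1 c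
    rw [hB e heP]
    intro b hb
    have hbP := hBP hb
    have hcb : inC EA CB c b := by
      rw [hB b hbP]
      intro b2 hb2
      obtain ⟨p1, _, q1, _, k, _, d1, e1, x1, x2, x3, x4⟩ := hBM b2 hb2 b hb
      exact (mackey_iff hbP).1 ⟨p1, q1, k, d1, e1, x1, x2, x3, x4⟩
    have hbq : inC EA CB b q := (hB q hq).1 (inC_of_le hq hc) b hb
    have hqb := inC_symm hbP hq hbq
    obtain ⟨hr, _, hrq⟩ := meet_comm hbP hq hqb
    have hcr := inC_meet hbP hq hqb hc hcb
    have hqr := inC_meet hbP hq hqb (le_refl' q) hqb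
    have hcr' := inC_diff hr hc' hcr hqr
    have hrp : inC EA CB (CB.J b q) p := by
      have : inCq EA CB q (CB.J b q) p := by
        apply hpc _ (Or.inl ⟨⟨hr, hrq⟩, ?_⟩)
        intro t ht
        rw [inCq_iff hq hr hrq]
        rcases ht with rfl | ht
        · exact ⟨le_right hc', hcr'⟩
        · rw [Set.mem_singleton_iff] at ht
          subst ht; exact ⟨hc, hcr⟩
      exact ((inCq_iff hq hpP hpq).1 this).2
    have hdr := inC_diff hr hd (inC_J hpP hr hrp hcr') (inC_J hpP hr hrp hcr)
    obtain ⟨x, y, hx, hy, hxy⟩ := (inC_iff hr).1 (cover_comm hspec hcov hr hdr)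
    apply inC_symm heP hbP
    refine (inC_iff hbP).2 ⟨x, y, le_tr hx (J_le hbP q), ?_, hxy⟩
    have := le_osub hq hrq (le_tr (le_right hxy) heq) hy
    rw [osub_eq hqb] at this
    exact le_tr this (J_le (P_compl hbP) q)
  refine ⟨heP, heq, hde, ?_, ?_, ?_⟩
  · exact pcomm ((inCq_iff hq heP heq).2 ⟨hc, hce⟩)
  · have k1 := J_add hu0 hcq
    have k2 := J_add hu0 hcq'
    have k3 := J_add hu0 hd
    rw [(J_zero_iff hu0).2 (le_tr hde (le_compl_symm (osub_le_compl heq))), padd_zero] at k3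
    have k4 := J_mono hu0 hle2
    have k5 := J_add hu0 hc'
    rw [J_ge hu0 (osub_le heq)] at k5
    rw [Option.some.inj k3] at k2
    obtain ⟨z, hz, hz2⟩ := padd_mono k2 (le_refl' _) k4
    have := pfun hz k1
    subst this
    exact padd_mono k5 (le_refl' _) hz2
  · refine ⟨CB.J e c', ?_, ?_⟩
    · have k1 := J_add heP hcq
      have k2 := J_add heP hcq'
      have k3 := J_add heP hd
      have hz : ∀ x, CB.J e (CB.J (EA.osub q p) x) = EA.zero := fun x =>
        (J_zero_iff heP).2 (le_tr (J_le hmp x) (le_tr (osub_le_compl hpq) (compl_anti hep)))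
      rw [hz, padd_zero] at k1 k2
      rw [Option.some.inj k1, Option.some.inj k2, J_fix heP hde] at k3
      exact k3
    · have := J_add heP hc'
      rw [J_ge heP heq] at this
      exact pcomm this

end comprs

end EffectAlgebra

namespace EffectAlgebra

section words

variable {E : Type u} {EA : EffectAlgebra E} {CB : CompressionBase EA}

theorem branch_aux (hspec : Spectral EA CB) (a : E) (t : List Bool)
    (hq : (ucAux EA CB a t).1 ∈ CB.P) (hc : EA.le (ucAux EA CB a t).2 (ucAux EA CB a t).1) :
    (ucAux EA CB a (false :: t)).1 ∈ CB.P ∧ (ucAux EA CB a (true :: t)).1 ∈ CB.P ∧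
    EA.le (ucAux EA CB a (false :: t)).2 (ucAux EA CB a (false :: t)).1 ∧
    EA.le (ucAux EA CB a (true :: t)).2 (ucAux EA CB a (true :: t)).1 ∧
    EA.padd (ucAux EA CB a (false :: t)).1 (ucAux EA CB a (true :: t)).1 =
      some (ucAux EA CB a t).1 ∧
    EA.padd (CB.J (ucAux EA CB a (false :: t)).1 (ucAux EA CB a t).2)
      (CB.J (ucAux EA CB a (true :: t)).1 (ucAux EA CB a t).2) = some (ucAux EA CB a t).2 ∧
    EA.padd (CB.J (ucAux EA CB a (false :: t)).1 (ucAux EA CB a t).2)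
      (CB.J (ucAux EA CB a (false :: t)).1 (ucAux EA CB a t).2) =
        some (ucAux EA CB a (false :: t)).2 ∧
    (∃ y, EA.padd y (ucAux EA CB a (true :: t)).2 =
        some (CB.J (ucAux EA CB a (true :: t)).1 (ucAux EA CB a t).2) ∧
      EA.padd y (CB.J (ucAux EA CB a (true :: t)).1 (ucAux EA CB a t).2) =
        some (ucAux EA CB a (true :: t)).1) := by
  obtain ⟨d, hd⟩ : ∃ d, d = posPartq EA CB (ucAux EA CB a t).1
    (EA.osub (ucAux EA CB a t).1 (ucAux EA CB a t).2) (ucAux EA CB a t).2 := ⟨_, rfl⟩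
  obtain ⟨e, he⟩ : ∃ e, e = projCoverq EA CB (ucAux EA CB a t).1 d := ⟨_, rfl⟩
  obtain ⟨heP, heq, hde, h1, ⟨v, hv, hv2⟩, h3⟩ := step hspec hq hc hd he
  have hu0P := osub_mem heP hq heq
  have m0 : pmeet EA CB (EA.osub (ucAux EA CB a t).1 e) (ucAux EA CB a t).1 =
      EA.osub (ucAux EA CB a t).1 e :=
    pmeet_eq ⟨hu0P, le_refl' _, osub_le heq, fun s _ h _ => h⟩
  have m1 : pmeet EA CB (ucAux EA CB a t).1 (EA.compl (EA.osub (ucAux EA CB a t).1 e)) = e := by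
    refine pmeet_eq ⟨heP, heq, le_compl_symm (osub_le_compl heq), fun s _ h h' => ?_⟩
    have := le_osub hq (osub_le heq) h h'
    rwa [osub_eq (pcomm (osub_spec heq))] at this
  have e0 : ucAux EA CB a (false :: t) = (EA.osub (ucAux EA CB a t).1 e, v) := by
    simp only [ucAux]
    rw [← hd, ← he, m0]
    simp [oplusD_eq hv]
  have e1 : ucAux EA CB a (true :: t) = (e, d) := by
    simp only [ucAux]
    rw [← hd, ← he, m0, m1]
    simp
  rw [e0, e1]
  exact ⟨hu0P, heP, hv2, hde, pcomm (osub_spec heq), h1, hv, h3⟩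

theorem node_aux (hspec : Spectral EA CB) (a : E) (t : List Bool) :
    (ucAux EA CB a t).1 ∈ CB.P ∧ EA.le (ucAux EA CB a t).2 (ucAux EA CB a t).1 := by
  induction t with
  | nil => exact ⟨(projCover_spec hspec a).1, cover_le (projCover_spec hspec a)⟩
  | cons b t ih =>
    have := branch_aux hspec a t ih.1 ih.2
    cases b
    · exact ⟨this.1, this.2.2.1⟩
    · exact ⟨this.2.1, this.2.2.2.1⟩

theorem uw_mem (hspec : Spectral EA CB) (a : E) (w : List Bool) : uw EA CB a w ∈ CB.P :=
  (node_aux hspec a w.reverse).1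

theorem cw_le (hspec : Spectral EA CB) (a : E) (w : List Bool) :
    EA.le (cw EA CB a w) (uw EA CB a w) :=
  (node_aux hspec a w.reverse).2

theorem branch (hspec : Spectral EA CB) (a : E) (w : List Bool) :
    EA.padd (uw EA CB a (w ++ [false])) (uw EA CB a (w ++ [true])) = some (uw EA CB a w) ∧
    EA.padd (CB.J (uw EA CB a (w ++ [false])) (cw EA CB a w))
      (CB.J (uw EA CB a (w ++ [true])) (cw EA CB a w)) = some (cw EA CB a w) ∧
    EA.padd (CB.J (uw EA CB a (w ++ [false])) (cw EA CB a w))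
      (CB.J (uw EA CB a (w ++ [false])) (cw EA CB a w)) = some (cw EA CB a (w ++ [false])) ∧
    (∃ y, EA.padd y (cw EA CB a (w ++ [true])) =
        some (CB.J (uw EA CB a (w ++ [true])) (cw EA CB a w)) ∧
      EA.padd y (CB.J (uw EA CB a (w ++ [true])) (cw EA CB a w)) =
        some (uw EA CB a (w ++ [true]))) := by
  have h := node_aux hspec a w.reverse
  have := branch_aux hspec a w.reverse h.1 h.2
  simp only [uw, cw, List.reverse_append, List.reverse_cons, List.reverse_nil, List.nil_append,
    List.cons_append]
  exact this.2.2.2.2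

theorem lam_append (w : List Bool) (b : Bool) :
    lamOf (w ++ [b]) = lamOf w + (if b then 1 else 0) / 2 ^ (w.length + 1) := by
  induction w with
  | nil => simp [lamOf]
  | cons c w ih =>
    simp only [List.cons_append, lamOf, ih, List.length_cons]
    rw [pow_succ _ (w.length + 1)]
    field_simp
    ring

theorem lam_nonneg (w : List Bool) : 0 ≤ lamOf w := by
  induction w with
  | nil => simp [lamOf]
  | cons c w ih =>
    simp only [lamOf]
    split_ifs <;> positivity

theorem lam_lt_one (w : List Bool) : lamOf w < 1 := by
  induction w with
  | nil => simp [lamOf]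
  | cons c w ih =>
    simp only [lamOf]
    split_ifs <;> linarith

theorem mem_all {n : ℕ} {w : List Bool} (h : w ∈ allStrings n) : w.length = n := by
  induction n generalizing w with
  | zero => simp [allStrings] at h; simp [h]
  | succ n ih =>
    simp only [allStrings, List.mem_flatMap] at h
    obtain ⟨v, hv, hw⟩ := h
    have := ih hv
    simp at hw
    rcases hw with rfl | rfl <;> simp [this]

theorem all_mem (w : List Bool) : w ∈ allStrings w.length := by
  induction w using List.reverseRecOn with
  | nil => simp [allStrings]
  | append_singleton w b ih =>
    simp only [List.length_append, List.length_singleton, allStrings, List.mem_flatMap]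
    refine ⟨w, ih, ?_⟩
    cases b <;> simp

theorem sum_all_succ {M : Type*} [AddCommMonoid M] (n : ℕ) (f : List Bool → M) :
    ((allStrings (n+1)).map f).sum =
      ((allStrings n).map fun w => f (w ++ [false]) + f (w ++ [true])).sum := by
  simp only [allStrings]
  generalize allStrings n = l
  induction l with
  | nil => simp
  | cons w l ih =>
    simp only [List.flatMap_cons, List.map_append, List.sum_append, List.map_cons, List.sum_cons, ih]
    simp

/-- pairwise orthogonality at level `n` -/
theorem pairwise_orth (hspec : Spectral EA CB) (a : E) (n : ℕ) :
    (allStrings n).Pairwise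
      (fun v w => EA.le (uw EA CB a v) (EA.compl (uw EA CB a w))) := by
  induction n with
  | zero => simp [allStrings]
  | succ n ih =>
    have hl : ∀ w b, EA.le (uw EA CB a (w ++ [b])) (uw EA CB a w) := by
      intro w b
      have := (branch hspec a w).1
      cases b
      · exact le_left this
      · exact le_right this
    rw [allStrings, List.pairwise_flatMap]
    constructor
    · intro w _
      simp only [List.pairwise_cons, List.mem_singleton, forall_eq, List.not_mem_nil,
        IsEmpty.forall_iff, implies_true, List.Pairwise.nil, and_true]
      exact orth_iff.1 ⟨_, (branch hspec a w).1⟩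
    · refine ih.imp ?_
      intro v w hvw x hx y hy
      have hx' : EA.le (uw EA CB a x) (uw EA CB a v) := by
        simp at hx
        rcases hx with rfl | rfl <;> exact hl _ _
      have hy' : EA.le (uw EA CB a y) (uw EA CB a w) := by
        simp at hy
        rcases hy with rfl | rfl <;> exact hl _ _
      exact le_tr hx' (le_tr hvw (compl_anti hy'))

theorem uw_le_cover (hspec : Spectral EA CB) (a : E) (w : List Bool) :
    EA.le (uw EA CB a w) (projCover EA CB a) := by
  induction w using List.reverseRecOn with
  | nil => exact le_refl' _
  | append_singleton w b ih =>
    have := (branch hspec a w).1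
    cases b
    · exact le_tr (le_left this) ih
    · exact le_tr (le_right this) ih

theorem foldl_sum {s : E → ℝ} (hs : EA.IsState s) (l : List E) (acc : E)
    (hP : ∀ x ∈ l, x ∈ CB.P) (hacc : ∀ x ∈ l, EA.le acc (EA.compl x))
    (hl : l.Pairwise fun x y => EA.le x (EA.compl y)) :
    s (l.foldl (fun acc x => EA.oplusD acc x) acc) = s acc + (l.map s).sum := by
  induction l generalizing acc with
  | nil => simp
  | cons x l ih =>
    rw [List.pairwise_cons] at hl
    obtain ⟨c, hc⟩ := orth_iff.2 (hacc x (by simp))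
    simp only [List.foldl_cons, List.map_cons, List.sum_cons, oplusD_eq hc]
    rw [ih c (fun y hy => hP y (by simp [hy])) _ hl.2, hs.2.2 _ _ _ hc]
    · ring
    · intro y hy
      exact principal (P_compl (hP y (by simp [hy]))) (hacc y (by simp [hy])) (hl.1 y hy) hc

theorem state_zero {s : E → ℝ} (hs : EA.IsState s) : s EA.zero = 0 := by
  have := hs.2.2 _ _ _ (padd_zero EA.zero)
  linarith

theorem state_compl {s : E → ℝ} (hs : EA.IsState s) (a : E) : s (EA.compl a) = 1 - s a := by
  have := hs.2.2 _ _ _ (compl_spec a)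
  rw [hs.1] at this
  linarith

theorem state_mono {s : E → ℝ} (hs : EA.IsState s) {a b : E} (h : EA.le a b) : s a ≤ s b := by
  obtain ⟨c, hc⟩ := h
  have := hs.2.2 _ _ _ hc
  have := (hs.2.1 c).1
  linarith

theorem state_u (hspec : Spectral EA CB) {s : E → ℝ} (hs : EA.IsState s) (a : E) (w : List Bool) :
    s (uw EA CB a w) = s (uw EA CB a (w ++ [false])) + s (uw EA CB a (w ++ [true])) :=
  hs.2.2 _ _ _ (branch hspec a w).1

theorem state_c (hspec : Spectral EA CB) {s : E → ℝ} (hs : EA.IsState s) (a : E) (w : List Bool) :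
    s (cw EA CB a w) = (s (cw EA CB a (w ++ [false])) + s (cw EA CB a (w ++ [true])) +
      s (uw EA CB a (w ++ [true]))) / 2 := by
  obtain ⟨_, h2, h3, y, h4, h5⟩ := branch hspec a w
  have := hs.2.2 _ _ _ h2
  have := hs.2.2 _ _ _ h3
  have := hs.2.2 _ _ _ h4
  have := hs.2.2 _ _ _ h5
  linarith

theorem sum_u (hspec : Spectral EA CB) {s : E → ℝ} (hs : EA.IsState s) (a : E) (n : ℕ) :
    ((allStrings n).map fun w => s (uw EA CB a w)).sum = s (projCover EA CB a) := by
  induction n with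
  | zero => simp [allStrings, uw, ucAux]
  | succ n ih =>
    rw [sum_all_succ, ← ih]
    congr 2
    funext w
    exact (state_u hspec hs a w).symm

theorem sum_c (hspec : Spectral EA CB) {s : E → ℝ} (hs : EA.IsState s) (a : E) (n : ℕ) :
    ((allStrings n).map fun w => ((lamOf w : ℚ) : ℝ) * s (uw EA CB a w)
      + (1 / 2) ^ w.length * s (cw EA CB a w)).sum = s a := by
  induction n with
  | zero => simp [allStrings, cw, ucAux, lamOf]
  | succ n ih =>
    rw [sum_all_succ]
    conv_rhs => rw [← ih]
    congr 2
    funext w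
    rw [state_u hspec hs a w, state_c hspec hs a w, lam_append, lam_append]
    simp only [List.length_append, List.length_singleton]
    push_cast
    simp only [one_div, inv_pow, pow_succ]
    simp
    field_simp
    ring

theorem sum_split (hspec : Spectral EA CB) {s : E → ℝ} (hs : EA.IsState s) (a : E) (n : ℕ) :
    ((allStrings n).map fun w => ((lamOf w : ℚ) : ℝ) * s (uw EA CB a w)).sum
      + (1 / 2) ^ n * ((allStrings n).map fun w => s (cw EA CB a w)).sum = s a := by
  rw [← sum_c hspec hs a n, ← List.sum_map_mul_left, ← List.sum_map_add]
  congr 1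
  apply List.map_congr_left
  intro w hw
  rw [mem_all hw]

theorem c_bounds (hspec : Spectral EA CB) {s : E → ℝ} (hs : EA.IsState s) (a : E) (n : ℕ) :
    0 ≤ ((allStrings n).map fun w => s (cw EA CB a w)).sum ∧
    ((allStrings n).map fun w => s (cw EA CB a w)).sum ≤ 1 := by
  constructor
  · apply List.sum_nonneg
    intro x hx
    simp only [List.mem_map] at hx
    obtain ⟨w, _, rfl⟩ := hx
    exact (hs.2.1 _).1
  · refine le_trans ?_ ((sum_u hspec hs a n).le.trans (hs.2.1 _).2)
    apply List.sum_le_sum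
    intro w _
    exact state_mono hs (cw_le hspec a w)

theorem part_lim (hspec : Spectral EA CB) {s : E → ℝ} (hs : EA.IsState s) (a : E) :
    Filter.Tendsto
        (fun n : ℕ =>
          ((allStrings n).map fun w => ((lamOf w : ℚ) : ℝ) * s (uw EA CB a w)).sum)
        Filter.atTop (nhds (s a)) := by
  have h0 : Filter.Tendsto (fun n : ℕ => ((1:ℝ) / 2) ^ n *
      ((allStrings n).map fun w => s (cw EA CB a w)).sum) Filter.atTop (nhds 0) := by
    apply squeeze_zero (g := fun n : ℕ => ((1:ℝ)/2)^n)
    · intro n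
      exact mul_nonneg (by positivity) (c_bounds hspec hs a n).1
    · intro n
      exact mul_le_of_le_one_right (by positivity) (c_bounds hspec hs a n).2
    · exact tendsto_pow_atTop_nhds_zero_of_lt_one (by norm_num) (by norm_num)
  have h1 := (tendsto_const_nhds (x := s a)).sub h0
  rw [sub_zero] at h1
  refine h1.congr fun n => ?_
  rw [← sum_split hspec hs a n]
  ring

theorem part_zero (hspec : Spectral EA CB) {s : E → ℝ} (hs : EA.IsState s) (a : E) :
    s a = 0 ↔ ∀ w : List Bool, lamOf w ≠ 0 → s (uw EA CB a w) = 0 := by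
  constructor
  · intro h w hw
    have h1 := sum_split hspec hs a w.length
    have h2 := (c_bounds hspec hs a w.length).1
    have h3 : ((lamOf w : ℚ) : ℝ) * s (uw EA CB a w) ≤
        ((allStrings w.length).map fun w => ((lamOf w : ℚ) : ℝ) * s (uw EA CB a w)).sum := by
      apply List.single_le_sum
      · intro x hx
        simp only [List.mem_map] at hx
        obtain ⟨v, _, rfl⟩ := hx
        exact mul_nonneg (by exact_mod_cast lam_nonneg v) (hs.2.1 _).1
      · exact List.mem_map.2 ⟨w, all_mem w, rfl⟩
    have h4 : (0:ℝ) ≤ (1/2)^w.length * ((allStrings w.length).map fun w => s (cw EA CB a w)).sum :=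
      mul_nonneg (by positivity) h2
    have h5 : (0:ℝ) < (lamOf w : ℚ) := by
      exact_mod_cast lt_of_le_of_ne (lam_nonneg w) (Ne.symm hw)
    have h6 := (hs.2.1 (uw EA CB a w)).1
    have h7 : ((lamOf w : ℚ) : ℝ) * s (uw EA CB a w) ≤ 0 := by linarith
    nlinarith
  · intro h
    have hl := part_lim hspec hs a
    have : (fun n : ℕ =>
          ((allStrings n).map fun w => ((lamOf w : ℚ) : ℝ) * s (uw EA CB a w)).sum) =
          fun _ => 0 := by
      funext n
      apply List.sum_eq_zero
      intro x hx
      simp only [List.mem_map] at hx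
      obtain ⟨v, _, rfl⟩ := hx
      by_cases hv : lamOf v = 0
      · simp [hv]
      · simp [h v hv]
    rw [this] at hl
    exact tendsto_nhds_unique hl tendsto_const_nhds

theorem part_sigma (hspec : Spectral EA CB) {s : E → ℝ} (hs : EA.IsState s) (a : E)
    (hA : EA.ArchimedeanEA) (hS : EA.SigmaAdditive s) :
    s a = 0 ↔ s (projCover EA CB a) = 0 := by
  have hcov := projCover_spec hspec a
  constructor
  · intro h
    have hz := (part_zero hspec hs a).1 h
    set f : ℕ → E := fun n => uw EA CB a (List.replicate n false ++ [true]) with hf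
    have hrep : ∀ n, List.replicate (n+1) false = List.replicate n false ++ [false] := fun n => by
      rw [List.replicate_succ']
    have hstep : ∀ n, EA.padd (EA.partialSum f n) (uw EA CB a (List.replicate n false)) =
          some (projCover EA CB a) →
        EA.padd (EA.partialSum f n) (f n) = some (EA.partialSum f (n+1)) ∧
        EA.padd (EA.partialSum f (n+1)) (uw EA CB a (List.replicate (n+1) false)) =
          some (projCover EA CB a) := by
      intro n hn
      obtain ⟨t, ht, ht2⟩ := passoc' (pcomm (branch hspec a (List.replicate n false)).1) hn
      have : EA.partialSum f (n+1) = t := oplusD_eq ht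
      rw [this, hrep]
      exact ⟨ht, ht2⟩
    have hps : ∀ n, EA.padd (EA.partialSum f n) (uw EA CB a (List.replicate n false)) =
          some (projCover EA CB a) := by
      intro n
      induction n with
      | zero => exact zero_padd _
      | succ n ih => exact (hstep n ih).2
    have key := hS f (projCover EA CB a) (fun n => ⟨_, (hstep n (hps n)).1⟩)
      (fun n => le_left (hps n)) ?_
    · have h0 : (fun n => ∑ i ∈ Finset.range n, s (f i)) = fun _ => 0 := by
        funext n
        apply Finset.sum_eq_zero
        intro i _
        apply hz
        rw [lam_append]
        have := lam_nonneg (List.replicate i false)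
        simp only [if_true]
        positivity
      rw [h0] at key
      exact tendsto_nhds_unique key tendsto_const_nhds
    · intro c hc
      have hy := projCover_spec hspec (EA.compl c)
      set y := projCover EA CB (EA.compl c)
      have hfc : ∀ n, EA.le (f n) c := fun n =>
        le_tr (le_right (hstep n (hps n)).1) (hc (n+1))
      have hfy : ∀ n, EA.le (f n) (EA.compl y) := by
        intro n
        apply le_compl_symm
        exact (hy.2 _ (P_compl (uw_mem hspec a _))).1 (compl_anti (hfc n))
      have hJ : CB.J y a = EA.zero := by
        apply arch_double hA (fun n => CB.J y (cw EA CB a (List.replicate n false)))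
        intro n
        obtain ⟨_, h2, h3, _⟩ := branch hspec a (List.replicate n false)
        have k2 := J_add hy.1 h2
        have k3 := J_add hy.1 h3
        rw [(J_zero_iff hy.1).2 (le_tr (J_le (uw_mem hspec a _) _) (hfy n)), padd_zero] at k2
        rw [Option.some.inj k2] at k3
        rw [hrep]
        exact k3
      have h1 := (J_zero_iff hy.1).1 hJ
      have h2 := (hcov.2 _ (P_compl hy.1)).1 h1
      apply le_tr h2
      apply le_of_compl
      rw [compl_compl]
      exact cover_le hy
  · intro h
    exact le_antisymm (h ▸ state_mono hs (cover_le hcov)) (hs.2.1 a).1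

end words

end EffectAlgebra

namespace EffectAlgebra

section resolution

variable {E : Type u} {EA : EffectAlgebra E} {CB : CompressionBase EA}

theorem lam_grid (w : List Bool) : ∃ k : ℕ, lamOf w = (k : ℚ) / 2 ^ w.length := by
  induction w using List.reverseRecOn with
  | nil => exact ⟨0, by simp [lamOf]⟩
  | append_singleton w b ih =>
    obtain ⟨k, hk⟩ := ih
    refine ⟨2 * k + (if b then 1 else 0), ?_⟩
    rw [lam_append, hk]
    simp only [List.length_append, List.length_singleton, pow_succ]
    cases b
    · simp; field_simp
    · simp; field_simp

theorem grid_mono {x : ℚ} {n m : ℕ} (hnm : n ≤ m) (h : ∃ k : ℕ, x = (k : ℚ) / 2 ^ n) :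
    ∃ k : ℕ, x = (k : ℚ) / 2 ^ m := by
  obtain ⟨k, hk⟩ := h
  obtain ⟨j, rfl⟩ := Nat.exists_eq_add_of_le hnm
  refine ⟨k * 2 ^ j, ?_⟩
  rw [hk, pow_add]
  push_cast
  field_simp

/-- grid comparisons -/
theorem grid_lt {x y : ℚ} {m : ℕ} (hx : ∃ k : ℕ, x = (k : ℚ) / 2 ^ m)
    (hy : ∃ k : ℕ, y = (k : ℚ) / 2 ^ m) :
    (x + 1 / 2 ^ (m + 1) < y ↔ x < y) ∧ (x + 1 / 2 ^ (m + 1) ≤ y ↔ x < y) ∧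
    (x < y + 1 / 2 ^ (m + 1) ↔ x ≤ y) ∧ (x ≤ y + 1 / 2 ^ (m + 1) ↔ x ≤ y) ∧
    (x < y + 1 / 2 ^ m ↔ x ≤ y) := by
  obtain ⟨j, rfl⟩ := hx
  obtain ⟨k, rfl⟩ := hy
  have hp : (0 : ℚ) < 2 ^ m := by positivity
  have e : (1 : ℚ) / 2 ^ (m + 1) = (1 / 2) / 2 ^ m := by rw [pow_succ]; field_simp
  rw [e, ← add_div, ← add_div, ← add_div]
  simp only [div_lt_div_iff_of_pos_right hp, div_le_div_iff_of_pos_right hp]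
  refine ⟨?_, ?_, ?_, ?_, ?_⟩
  · constructor
    · intro h; linarith
    · intro h
      have : j + 1 ≤ k := by exact_mod_cast h
      have : (j : ℚ) + 1 ≤ k := by exact_mod_cast this
      linarith
  · constructor
    · intro h; linarith
    · intro h
      have : j + 1 ≤ k := by exact_mod_cast h
      have : (j : ℚ) + 1 ≤ k := by exact_mod_cast this
      linarith
  · constructor
    · intro h
      by_contra hc
      push Not at hc
      have : k + 1 ≤ j := by exact_mod_cast hc
      have : (k : ℚ) + 1 ≤ j := by exact_mod_cast this
      linarith
    · intro h; linarith
  · constructor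
    · intro h
      by_contra hc
      push Not at hc
      have : k + 1 ≤ j := by exact_mod_cast hc
      have : (k : ℚ) + 1 ≤ j := by exact_mod_cast this
      linarith
    · intro h; linarith
  · constructor
    · intro h
      have : j < k + 1 := by exact_mod_cast h
      exact_mod_cast Nat.lt_succ_iff.1 this
    · intro h; linarith

/-- the distribution function at level `n` -/
noncomputable def distS (CB : CompressionBase EA) (s : E → ℝ) (a : E) (n : ℕ) (x : ℚ) : ℝ :=
  ((allStrings n).map fun v => if lamOf v < x then s (uw EA CB a v) else 0).sum

theorem distS_succ (hspec : Spectral EA CB) {s : E → ℝ} (hs : EA.IsState s) (a : E) {n : ℕ} {x : ℚ}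
    (hx : ∃ k : ℕ, x = (k : ℚ) / 2 ^ n) : distS CB s a (n+1) x = distS CB s a n x := by
  unfold distS
  rw [sum_all_succ]
  congr 1
  apply List.map_congr_left
  intro v hv
  have hg : ∃ k : ℕ, lamOf v = (k : ℚ) / 2 ^ n := mem_all hv ▸ lam_grid v
  have := (grid_lt hg hx).1
  rw [lam_append, lam_append, mem_all hv, state_u hspec hs a v]
  simp only [if_true, this]
  by_cases h : lamOf v < x <;> simp [h]

theorem distS_le (hspec : Spectral EA CB) {s : E → ℝ} (hs : EA.IsState s) (a : E) {n m : ℕ} {x : ℚ}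
    (hnm : n ≤ m) (hx : ∃ k : ℕ, x = (k : ℚ) / 2 ^ n) : distS CB s a m x = distS CB s a n x := by
  induction hnm with
  | refl => rfl
  | step h ih => rw [distS_succ hspec hs a (grid_mono h hx), ih]

theorem distS_eq (hspec : Spectral EA CB) {s : E → ℝ} (hs : EA.IsState s) (a : E) {n m : ℕ} {x : ℚ}
    (hn : ∃ k : ℕ, x = (k : ℚ) / 2 ^ n) (hm : ∃ k : ℕ, x = (k : ℚ) / 2 ^ m) :
    distS CB s a m x = distS CB s a n x := by
  rw [← distS_le hspec hs a (le_max_left n m) hn, ← distS_le hspec hs a (le_max_right n m) hm]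

theorem sum_filter_map {α : Type*} (l : List α) (p : α → Bool) (f : α → ℝ) :
    ((l.filter p).map f).sum = (l.map fun v => if p v then f v else 0).sum := by
  induction l with
  | nil => simp
  | cons x l ih =>
    rw [List.filter_cons]
    by_cases h : p x <;> simp [h, ih]

theorem state_pbin (hspec : Spectral EA CB) {s : E → ℝ} (hs : EA.IsState s) (a : E) (w : List Bool) :
    s (pbin EA CB a w) =
      1 - s (projCover EA CB a) + distS CB s a (w.length + 1) (lamOf (w ++ [true])) := by
  unfold pbin listSum
  rw [foldl_sum (CB := CB) hs]
  · rw [state_zero hs, List.map_cons, List.sum_cons, state_compl hs, List.map_map, sum_filter_map,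
      zero_add]
    congr 1
    unfold distS
    congr 1
    apply List.map_congr_left
    intro v hv
    have hg : ∃ k : ℕ, lamOf v = (k : ℚ) / 2 ^ (w.length + 1) := mem_all hv ▸ lam_grid v
    have hg2 : ∃ k : ℕ, lamOf (w ++ [false]) = (k : ℚ) / 2 ^ (w.length + 1) := by
      have := lam_grid (w ++ [false])
      simpa using this
    have h1 := (grid_lt hg hg2).2.2.2.2
    have h2 : lamOf (w ++ [true]) = lamOf (w ++ [false]) + 1 / 2 ^ (w.length + 1) := by
      rw [lam_append, lam_append]; simp
    rw [h2]
    simp only [h1, Function.comp, decide_eq_true_eq]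
  · intro x hx
    simp only [List.mem_cons, List.mem_map, List.mem_filter] at hx
    rcases hx with rfl | ⟨v, _, rfl⟩
    · exact P_compl (projCover_spec hspec a).1
    · exact uw_mem hspec a v
  · intro x _
    exact zero_le' _
  · rw [List.pairwise_cons]
    constructor
    · intro x hx
      simp only [List.mem_map, List.mem_filter] at hx
      obtain ⟨v, _, rfl⟩ := hx
      exact compl_anti (uw_le_cover hspec a v)
    · rw [List.pairwise_map]
      exact (pairwise_orth hspec a _).filter _

theorem exists_trim (w : List Bool) (h : lamOf w ≠ 0) : ∃ v, lamOf (v ++ [true]) = lamOf w := by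
  induction w using List.reverseRecOn with
  | nil => simp [lamOf] at h
  | append_singleton w b ih =>
    cases b
    · have e : lamOf (w ++ [false]) = lamOf w := by rw [lam_append]; simp
      rw [e] at h ⊢
      exact ih h
    · exact ⟨w, rfl⟩

theorem distS_agree (hspec : Spectral EA CB) {s : E → ℝ} (hs : EA.IsState s) (a b : E)
    (hab : ∀ w : List Bool, pdyad EA CB a (lamOf w) = pdyad EA CB b (lamOf w)) (w : List Bool) :
    s (projCover EA CB a) = s (projCover EA CB b) ∧
    distS CB s a w.length (lamOf w) = distS CB s b w.length (lamOf w) := by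
  have hc : s (projCover EA CB a) = s (projCover EA CB b) := by
    have := hab []
    simp only [lamOf, pdyad, le_refl, if_true] at this
    have := congrArg s this
    rw [state_compl hs, state_compl hs] at this
    linarith
  refine ⟨hc, ?_⟩
  by_cases h0 : lamOf w = 0
  · have : ∀ a, distS CB s a w.length (lamOf w) = 0 := by
      intro a
      apply List.sum_eq_zero
      intro x hx
      simp only [List.mem_map] at hx
      obtain ⟨v, _, rfl⟩ := hx
      rw [if_neg]
      rw [h0]
      exact not_lt.2 (lam_nonneg v)
    rw [this, this]
  · have hex := exists_trim w h0
    have hpos : ¬ lamOf w ≤ 0 := not_le.2 (lt_of_le_of_ne (lam_nonneg w) (Ne.symm h0))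
    have hlt : ¬ 1 ≤ lamOf w := not_le.2 (lam_lt_one w)
    have h1 := congrArg s (hab w)
    unfold pdyad at h1
    rw [if_neg hpos, if_neg hlt, dif_pos hex, if_neg hpos, if_neg hlt, dif_pos hex,
      state_pbin hspec hs, state_pbin hspec hs, hc, hex.choose_spec] at h1
    have hg : ∃ k : ℕ, lamOf w = (k : ℚ) / 2 ^ (hex.choose.length + 1) := by
      have := lam_grid (hex.choose ++ [true])
      rw [hex.choose_spec] at this
      simpa using this
    rw [distS_eq hspec hs a (lam_grid w) hg, distS_eq hspec hs b (lam_grid w) hg] at h1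
    linarith

theorem count_all (v : List Bool) :
    ((allStrings v.length).map fun w => if lamOf w < lamOf v then (1:ℝ) else 0).sum
      = 2 ^ v.length * ((lamOf v : ℚ) : ℝ) ∧
    ((allStrings v.length).map fun w => if lamOf w ≤ lamOf v then (1:ℝ) else 0).sum
      = 2 ^ v.length * ((lamOf v : ℚ) : ℝ) + 1 := by
  induction v using List.reverseRecOn with
  | nil => simp [allStrings, lamOf]
  | append_singleton v b ih =>
    obtain ⟨ih1, ih2⟩ := ih
    have hg : ∀ w ∈ allStrings v.length, ∃ k : ℕ, lamOf w = (k : ℚ) / 2 ^ v.length :=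
      fun w hw => mem_all hw ▸ lam_grid w
    have hl : (v ++ [b]).length = v.length + 1 := by simp
    rw [hl, sum_all_succ, sum_all_succ]
    have key : ∀ (f g : List Bool → ℝ), (∀ w ∈ allStrings v.length, f w = g w) →
        ((allStrings v.length).map f).sum = ((allStrings v.length).map g).sum := by
      intro f g h
      congr 1
      exact List.map_congr_left h
    cases b
    · have e : lamOf (v ++ [false]) = lamOf v := by rw [lam_append]; simp
      rw [e]
      constructor
      · rw [key _ (fun w => (if lamOf w < lamOf v then (1:ℝ) else 0) +
          (if lamOf w < lamOf v then (1:ℝ) else 0)), List.sum_map_add, ih1]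
        · ring
        · intro w hw
          rw [lam_append, lam_append, mem_all hw]
          simp only [if_true, (grid_lt (hg w hw) (lam_grid v)).1]
          simp
      · rw [key _ (fun w => (if lamOf w ≤ lamOf v then (1:ℝ) else 0) +
          (if lamOf w < lamOf v then (1:ℝ) else 0)), List.sum_map_add, ih1, ih2]
        · ring
        · intro w hw
          rw [lam_append, lam_append, mem_all hw]
          simp only [if_true, (grid_lt (hg w hw) (lam_grid v)).2.1]
          simp
    · have e : lamOf (v ++ [true]) = lamOf v + 1 / 2 ^ (v.length + 1) := by rw [lam_append]; simp
      rw [e]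
      have e2 : (2:ℝ) ^ (v.length + 1) * ((lamOf v + 1 / 2 ^ (v.length + 1) : ℚ) : ℝ) =
          2 * (2 ^ v.length * ((lamOf v : ℚ) : ℝ)) + 1 := by
        push_cast
        rw [pow_succ]
        field_simp
      rw [e2]
      constructor
      · rw [key _ (fun w => (if lamOf w ≤ lamOf v then (1:ℝ) else 0) +
          (if lamOf w < lamOf v then (1:ℝ) else 0)), List.sum_map_add, ih1, ih2]
        · ring
        · intro w hw
          rw [lam_append, lam_append, mem_all hw]
          simp only [if_true, add_lt_add_iff_right]
          simp only [Bool.false_eq_true, if_false, zero_div, add_zero,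
            (grid_lt (hg w hw) (lam_grid v)).2.2.1]
      · rw [key _ (fun w => (if lamOf w ≤ lamOf v then (1:ℝ) else 0) +
          (if lamOf w ≤ lamOf v then (1:ℝ) else 0)), List.sum_map_add, ih2]
        · ring
        · intro w hw
          rw [lam_append, lam_append, mem_all hw]
          simp only [if_true, add_le_add_iff_right]
          simp only [Bool.false_eq_true, if_false, zero_div, add_zero,
            (grid_lt (hg w hw) (lam_grid v)).2.2.2.1]

theorem sum_swap {α : Type*} (l m : List α) (f : α → α → ℝ) :
    (l.map fun x => (m.map fun y => f x y).sum).sum =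
      (m.map fun y => (l.map fun x => f x y).sum).sum := by
  induction l with
  | nil => simp
  | cons x l ih => simp [ih, List.sum_map_add]

theorem riemann_dist (hspec : Spectral EA CB) {s : E → ℝ} (hs : EA.IsState s) (a : E) (n : ℕ) :
    2 ^ n * ((allStrings n).map fun w => ((lamOf w : ℚ) : ℝ) * s (uw EA CB a w)).sum
      + s (projCover EA CB a) =
    ((allStrings n).map fun w => s (projCover EA CB a) - distS CB s a n (lamOf w)).sum := by
  have h1 : ∀ w, s (projCover EA CB a) - distS CB s a n (lamOf w) =
      ((allStrings n).map fun v => (if lamOf w ≤ lamOf v then (1:ℝ) else 0) * s (uw EA CB a v)).sum := by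
    intro w
    rw [sub_eq_iff_eq_add, ← sum_u hspec hs a n, distS, ← List.sum_map_add]
    congr 1
    apply List.map_congr_left
    intro v _
    by_cases h : lamOf w ≤ lamOf v
    · simp [h, not_lt.2 h]
    · simp [h, not_le.1 h]
  simp only [h1]
  rw [sum_swap]
  rw [← sum_u hspec hs a n, ← List.sum_map_mul_left, ← List.sum_map_add]
  congr 1
  apply List.map_congr_left
  intro v hv
  rw [List.sum_map_mul_right]
  have := (count_all v).2
  rw [mem_all hv] at this
  rw [this]
  ring

theorem part_eq (hspec : Spectral EA CB) {s : E → ℝ} (hs : EA.IsState s) (a b : E)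
    (hab : ∀ w : List Bool, pdyad EA CB a (lamOf w) = pdyad EA CB b (lamOf w)) : s a = s b := by
  have ha := part_lim hspec hs a
  have hb := part_lim hspec hs b
  refine tendsto_nhds_unique ha (hb.congr fun n => ?_)
  have h1 := riemann_dist hspec hs a n
  have h2 := riemann_dist hspec hs b n
  have h3 : ((allStrings n).map fun w => s (projCover EA CB a) - distS CB s a n (lamOf w)).sum =
      ((allStrings n).map fun w => s (projCover EA CB b) - distS CB s b n (lamOf w)).sum := by
    congr 1
    apply List.map_congr_left
    intro w hw
    have := distS_agree hspec hs a b hab w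
    rw [mem_all hw] at this
    rw [this.1, this.2]
  rw [← h1, ← h2, (distS_agree hspec hs a b hab []).1] at h3
  have hp : (0:ℝ) < 2 ^ n := by positivity
  have h4 := add_right_cancel h3
  exact (mul_left_cancel₀ hp.ne' h4).symm

end resolution

end EffectAlgebra

open EffectAlgebra in
/-- in a spectral effect algebra, for the families `{c_w}, {u_w}`
associated with the binary spectral resolution of `a` and any state `s`:
(i) `s(a) = lim_n Σ_{l(w)=n} λ(w) s(u_w)`, and `s(a) = 0` iff `s(u_w) = 0` for all `w`
with `λ(w) ≠ 0`; (ii) if `E` is archimedean and `s` is σ-additive, `s(a) = 0` iff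
`s(a°) = 0`; (iii) if `b` has the same binary spectral resolution, `s(a) = s(b)`. -/
theorem statement16 {E : Type u} (EA : EffectAlgebra E) (CB : CompressionBase EA)
    (hspec : Spectral EA CB) (a : E) (s : E → ℝ) (hs : EA.IsState s) :
    (Filter.Tendsto
        (fun n : ℕ =>
          ((allStrings n).map fun w => ((lamOf w : ℚ) : ℝ) * s (uw EA CB a w)).sum)
        Filter.atTop (nhds (s a)) ∧
      (s a = 0 ↔ ∀ w : List Bool, lamOf w ≠ 0 → s (uw EA CB a w) = 0)) ∧
    (EA.ArchimedeanEA → EA.SigmaAdditive s →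
      (s a = 0 ↔ s (projCover EA CB a) = 0)) ∧
    (∀ b : E,
      (∀ w : List Bool, pdyad EA CB a (lamOf w) = pdyad EA CB b (lamOf w)) →
      s a = s b) := by
  exact ⟨⟨part_lim hspec hs a, part_zero hspec hs a⟩, part_sigma hspec hs a,
    fun b hab => part_eq hspec hs a b hab⟩
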